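/- Let N ≥ 1 and s be natural numbers with s > 5, and a : Fin s → ZMod N with a j ≠ 0 for every j and ∑_j a j = 0 in ZMod N. Assume ∑_j (a j).val > 2N and ∑_j (−(a j)).val > 2N. Then ((∑_j (−(a j)).val)/N − 1) · ((∑_j (a j).val)/N − 1) > s − 3. -/

import Mathlib

theorem ZMod.val_add_val_neg {N : ℕ} [NeZero N] {x : ZMod N} (hx : x ≠ 0) :
    x.val + (-x).val = N := by
  rw [ZMod.neg_val, if_neg hx]
  exact Nat.add_sub_cancel' x.val_le

theorem ZMod.dvd_sum_val {ι : Type*} {N : ℕ} [NeZero N] (t : Finset ι) {a : ι → ZMod N}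
    (ha : ∑ j ∈ t, a j = 0) : N ∣ ∑ j ∈ t, (a j).val := by
  rw [← ZMod.natCast_eq_zero_iff, Nat.cast_sum]
  simpa using ha

/-- Arithmetic content of Proposition 3.2: with all `a j` nonzero, zero sum, both
representative-sums exceeding `2N`, and `s > 5`, the product of the eigenspace
dimensions exceeds `s - 3`. -/
theorem prym_cyclic_not_special (N s : ℕ) (hN : 1 ≤ N) (hs : 5 < s)
    (a : Fin s → ZMod N) (hne : ∀ j, a j ≠ 0) (ha : ∑ j, a j = 0)
    (h1 : 2 * N < ∑ j, (a j).val) (h2 : 2 * N < ∑ j, (-(a j)).val) :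
    s - 3 < ((∑ j, (-(a j)).val) / N - 1) * ((∑ j, (a j).val) / N - 1) := by
  have : NeZero N := ⟨by omega⟩
  have hsum : ∑ j, (a j).val + ∑ j, (-(a j)).val = N * s := by
    rw [← Finset.sum_add_distrib, Finset.sum_congr rfl fun j _ => ZMod.val_add_val_neg (hne j)]
    simp [mul_comm]
  obtain ⟨p, hp⟩ := ZMod.dvd_sum_val Finset.univ ha
  obtain ⟨q, hq⟩ := ZMod.dvd_sum_val (a := fun j => -a j) Finset.univ (by simp [ha])
  rw [hp] at h1 hsum ⊢
  rw [hq] at h2 hsum ⊢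
  rw [Nat.mul_div_cancel_left _ hN, Nat.mul_div_cancel_left _ hN]
  rw [mul_comm 2 N] at h1 h2
  have hp3 : 2 < p := Nat.lt_of_mul_lt_mul_left h1
  have hq3 : 2 < q := Nat.lt_of_mul_lt_mul_left h2
  have hpq : p + q = s := Nat.eq_of_mul_eq_mul_left hN (by rw [mul_add, hsum])
  obtain ⟨x, rfl⟩ := Nat.exists_eq_add_of_le hp3
  obtain ⟨y, rfl⟩ := Nat.exists_eq_add_of_le hq3
  have hx : 2 + 1 + x - 1 = x + 2 := by omega
  have hy : 2 + 1 + y - 1 = y + 2 := by omega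
  have hs3 : s - 3 = x + y + 3 := by omega
  rw [hx, hy, hs3]
  nlinarith [Nat.zero_le (x * y)]
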